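/- With the reduction construction below, the graph G admits a k-clique if and only if there exists a ρ-matching from (X,d_X) to (Y,d_Y). -/

import Mathlib

/-- Circular distance between the `j`-th and `j'`-th of `m` points spaced regularly
on a circle of perimeter 1: `(1/m) · min(j'−j, m+j−j')` for `j ≤ j'`. -/
noncomputable def ringDist (m : ℕ) (j j' : Fin m) : ℝ :=
  ((min (max j.val j'.val - min j.val j'.val)
        (m - (max j.val j'.val - min j.val j'.val)) : ℕ) : ℝ) / (m : ℝ)

/-- The distance on `Y = R_1 ∪ … ∪ R_k`, where `R_i = {p_{i1},…,p_{im}}` and the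
point `p_{ij}` (with `1 ≤ i ≤ k`, `1 ≤ j ≤ m`) is encoded as
`(⟨i-1⟩, ⟨j-1⟩) : Fin k × Fin m`.  Within a ring the distance is the circular
distance `ringDist`; for `i ≠ i'`, `d_Y(p_{ij}, p_{i'j'}) = 2^{max(i,i')}` if
`(v_j, v_{j'}) ∈ E` and `2^{max(i,i')} − 1/m` otherwise (note
`max(i,i') = max(i-1,i'-1) + 1` in the 0-indexed encoding). -/
noncomputable def dY (m k : ℕ) (G : SimpleGraph (Fin m)) [DecidableRel G.Adj]
    (p q : Fin k × Fin m) : ℝ :=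
  if p.1 = q.1 then ringDist m p.2 q.2
  else if G.Adj p.2 q.2 then (2 : ℝ) ^ (max p.1.val q.1.val + 1)
  else (2 : ℝ) ^ (max p.1.val q.1.val + 1) - 1 / (m : ℝ)

/-- The distance on the pattern `X = {x_1,…,x_k}` (point `x_i` encoded as
`⟨i-1⟩ : Fin k`): `d_X(x_i, x_{i'}) = 2^{max(i,i')} · ρ` for `i ≠ i'`. -/
noncomputable def dX (k : ℕ) (ρ : ℝ) (i i' : Fin k) : ℝ :=
  if i = i' then 0 else (2 : ℝ) ^ (max i.val i'.val + 1) * ρ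

/-- `σ` is a `ρ`-matching from `(A, dA)` to `(B, dB)`:
`(1/ρ)·dA(a,a') ≤ dB(σ a, σ a') ≤ ρ·dA(a,a')` for all `a, a'`. -/
def IsRhoMatching {A B : Type*} (dA : A → A → ℝ) (dB : B → B → ℝ)
    (ρ : ℝ) (σ : A → B) : Prop :=
  ∀ a a', (1 / ρ) * dA a a' ≤ dB (σ a) (σ a') ∧ dB (σ a) (σ a') ≤ ρ * dA a a'

theorem ringDist_self (m : ℕ) (j : Fin m) : ringDist m j j = 0 := by
  simp [ringDist]

theorem ringDist_le_one (m : ℕ) (j j' : Fin m) : ringDist m j j' ≤ 1 := by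
  unfold ringDist
  apply div_le_one_of_le₀ _ (Nat.cast_nonneg m)
  exact_mod_cast (min_le_right _ _).trans (Nat.sub_le _ _)

theorem dY_le_two_pow {m k : ℕ} (G : SimpleGraph (Fin m)) [DecidableRel G.Adj]
    (p q : Fin k × Fin m) : dY m k G p q ≤ 2 ^ (max p.1.val q.1.val + 1) := by
  unfold dY
  split_ifs
  · exact (ringDist_le_one _ _ _).trans (one_le_pow₀ (by norm_num))
  · exact le_rfl
  · have : (0 : ℝ) ≤ 1 / m := by positivity
    linarith

/-- A permutation of `Fin k` that does not decrease the maximum of any two distinct elements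
preserves all these maxima. -/
theorem max_apply_eq_of_injective {k : ℕ} {f : Fin k → Fin k} (hf : f.Injective)
    (h : ∀ i j, i ≠ j → max i.val j.val ≤ max (f i).val (f j).val) {i j : Fin k} (hij : i ≠ j) :
    max (f i).val (f j).val = max i.val j.val := by
  let w : Fin k × Fin k → ℕ := fun p => if p.1 = p.2 then 0 else max p.1.val p.2.val
  let e : Fin k ≃ Fin k := Equiv.ofBijective f (Finite.injective_iff_bijective.mp hf)
  have hsum : ∑ p, w (e.prodCongr e p) = ∑ p, w p := (e.prodCongr e).sum_comp w
  have hle : ∀ p ∈ Finset.univ, w p ≤ w (e.prodCongr e p) := by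
    rintro ⟨a, b⟩ -
    by_cases hab : a = b
    · simp [w, hab]
    · simpa [w, hab, e, hf.eq_iff] using h a b hab
  have := (Finset.sum_eq_sum_iff_of_le hle).mp hsum.symm (i, j) (Finset.mem_univ _)
  simpa [w, hij, e, hf.eq_iff] using this.symm

theorem isRhoMatching_of_adj {m k : ℕ} {ρ : ℝ} (hρ : 1 ≤ ρ) (G : SimpleGraph (Fin m))
    [DecidableRel G.Adj] {v : Fin k → Fin m} (hv : ∀ i j, i ≠ j → G.Adj (v i) (v j)) :
    IsRhoMatching (dX k ρ) (dY m k G) ρ fun i => (i, v i) := by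
  intro i j
  by_cases hij : i = j
  · simp [dX, dY, hij, ringDist_self]
  · have hρ0 : ρ ≠ 0 := by positivity
    have hpow : (0 : ℝ) ≤ 2 ^ (max i.val j.val + 1) := by positivity
    simp only [dX, dY, hij, hv i j hij, if_true, if_false]
    constructor
    · exact le_of_eq (by field_simp)
    · nlinarith [mul_le_mul hρ hρ zero_le_one (zero_le_one.trans hρ)]

theorem IsRhoMatching.two_pow_le {m k : ℕ} {ρ : ℝ} (hρ : 1 ≤ ρ) {G : SimpleGraph (Fin m)}
    [DecidableRel G.Adj] {σ : Fin k → Fin k × Fin m}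
    (hσ : IsRhoMatching (dX k ρ) (dY m k G) ρ σ) {i j : Fin k} (hij : i ≠ j) :
    (2 : ℝ) ^ (max i.val j.val + 1) ≤ dY m k G (σ i) (σ j) := by
  have hρ0 : ρ ≠ 0 := by positivity
  refine le_of_eq_of_le ?_ (hσ i j).1
  simp only [dX, hij, if_false]
  field_simp

theorem IsRhoMatching.fst_injective {m k : ℕ} {ρ : ℝ} (hρ : 1 ≤ ρ) {G : SimpleGraph (Fin m)}
    [DecidableRel G.Adj] {σ : Fin k → Fin k × Fin m}
    (hσ : IsRhoMatching (dX k ρ) (dY m k G) ρ σ) : (fun i => (σ i).1).Injective := by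
  intro i j (h : (σ i).1 = (σ j).1)
  by_contra hij
  have h₁ := hσ.two_pow_le hρ hij
  rw [dY, if_pos h] at h₁
  have h₂ : (1 : ℝ) < 2 ^ (max i.val j.val + 1) := one_lt_pow₀ (by norm_num) (by omega)
  linarith [ringDist_le_one m (σ i).2 (σ j).2]

theorem IsRhoMatching.adj_snd {m k : ℕ} (hm : 0 < m) {ρ : ℝ} (hρ : 1 ≤ ρ)
    {G : SimpleGraph (Fin m)} [DecidableRel G.Adj] {σ : Fin k → Fin k × Fin m}
    (hσ : IsRhoMatching (dX k ρ) (dY m k G) ρ σ) {i j : Fin k} (hij : i ≠ j) :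
    G.Adj (σ i).2 (σ j).2 := by
  have hinj := hσ.fst_injective hρ
  have hmax : max (σ i).1.val (σ j).1.val = max i.val j.val := by
    refine max_apply_eq_of_injective hinj (fun a b hab => ?_) hij
    have := (hσ.two_pow_le hρ hab).trans (dY_le_two_pow G _ _)
    exact Nat.le_of_succ_le_succ ((pow_le_pow_iff_right₀ one_lt_two).mp this)
  by_contra hadj
  have h := hσ.two_pow_le hρ hij
  rw [dY, if_neg (hinj.ne hij), if_neg hadj, hmax] at h
  have : (0 : ℝ) < 1 / m := by positivity
  linarith

/-- **Theorem (correctness of the reduction).** With the reduction construction,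
`G` admits a `k`-clique if and only if there exists a `ρ`-matching from
`(X, d_X)` to `(Y, d_Y)`. -/
theorem stmt_9 (m k : ℕ) (hm : 24 ≤ m) (hk : 1 ≤ k) (hkm : k ≤ m)
    (ρ : ℝ) (hρ : 1 ≤ ρ) (G : SimpleGraph (Fin m)) [DecidableRel G.Adj] :
    (∃ s : Finset (Fin m), G.IsNClique k s) ↔
    (∃ σ : Fin k → Fin k × Fin m, IsRhoMatching (dX k ρ) (dY m k G) ρ σ) := by
  constructor
  · rintro ⟨s, hs⟩
    let e := s.equivFinOfCardEq hs.card_eq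
    refine ⟨_, isRhoMatching_of_adj hρ G (v := fun i => e.symm i) fun i j hij => ?_⟩
    exact hs.isClique (e.symm i).2 (e.symm j).2
      fun h => hij (e.symm.injective (Subtype.ext h))
  · rintro ⟨σ, hσ⟩
    have hadj : ∀ i j, i ≠ j → G.Adj (σ i).2 (σ j).2 := fun i j hij =>
      hσ.adj_snd (by omega) hρ hij
    have hinj : (fun i => (σ i).2).Injective := fun i j h => by
      by_contra hij
      exact (hadj i j hij).ne h
    refine ⟨Finset.univ.image fun i => (σ i).2, ?_, ?_⟩
    · intro a ha b hb hab
      simp only [Finset.coe_image, Finset.coe_univ, Set.image_univ, Set.mem_range] at ha hb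
      obtain ⟨i, rfl⟩ := ha
      obtain ⟨j, rfl⟩ := hb
      exact hadj i j fun h => hab (by rw [h])
    · rw [Finset.card_image_of_injective _ hinj, Finset.card_univ, Fintype.card_fin]
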